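/- Let n be a fixed integer and p : ℕ → (0,1), and let 𝔍 = 𝔍(D) be the random monomial ideal of the ER-type model with parameter p(D). Then 1/D is a threshold function for 0-dimensionality of S/𝔍: if D · p(D) → 0 as D → ∞, then P(dim S/𝔍 = 0) → 0; and if D · p(D) → ∞ as D → ∞, then P(dim S/𝔍 = 0) → 1. -/

import Mathlib

open Finset MvPolynomial Filter

noncomputable section

/-- The set of exponent vectors of nonconstant monomials in `n` variables of total degree
at most `D`. -/
def monSet (n D : ℕ) : Finset (Fin n → ℕ) :=
  (Fintype.piFinset fun _ : Fin n => Finset.range (D + 1)).filter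
    fun α => 0 < ∑ i, α i ∧ ∑ i, α i ≤ D

/-- The monomial `x^α` of `MvPolynomial (Fin n) K` with exponent vector `α`. -/
def mono (K : Type*) [CommRing K] {n : ℕ} (α : Fin n → ℕ) : MvPolynomial (Fin n) K :=
  MvPolynomial.monomial (Finsupp.equivFunOnFinite.symm α) 1

/-- The monomial ideal generated by a set of exponent vectors. -/
def idealOf (K : Type*) [CommRing K] {n : ℕ} (B : Finset (Fin n → ℕ)) :
    Ideal (MvPolynomial (Fin n) K) :=
  Ideal.span (mono K '' (B : Set (Fin n → ℕ)))

open Classical in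
/-- The probability, under the ER-type model `ℐ(n,D,p)`, of the event `E` on random
generating sets `𝔅 ⊆ M(n,D)`. -/
def ERprob (n D : ℕ) (p : ℝ) (E : Set (Finset (Fin n → ℕ))) : ℝ :=
  ∑ B ∈ (monSet n D).powerset.filter (· ∈ E),
    p ^ B.card * (1 - p) ^ ((monSet n D).card - B.card)

/-- `I` is a monomial ideal. -/
def IsMonomialIdeal (K : Type*) [CommRing K] {n : ℕ}
    (I : Ideal (MvPolynomial (Fin n) K)) : Prop :=
  ∃ G : Set (Fin n → ℕ), I = Ideal.span (mono K '' G)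

/-- `x^α` is a minimal monomial generator of `I`: it lies in `I` and no proper divisor does. -/
def IsMinGen (K : Type*) [CommRing K] {n : ℕ} (I : Ideal (MvPolynomial (Fin n) K))
    (α : Fin n → ℕ) : Prop :=
  mono K α ∈ I ∧ ∀ β : Fin n → ℕ, (∀ i, β i ≤ α i) → β ≠ α → mono K β ∉ I

/-- `β₁(S/I)`: the number of minimal monomial generators of `I`. -/
def beta1 (K : Type*) [CommRing K] {n : ℕ} (I : Ideal (MvPolynomial (Fin n) K)) : ℕ :=
  {α : Fin n → ℕ | IsMinGen K I α}.ncard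

/-- `β_{1,d}(S/I)`: the number of minimal monomial generators of `I` of degree `d`. -/
def beta1d (K : Type*) [CommRing K] {n : ℕ} (I : Ideal (MvPolynomial (Fin n) K)) (d : ℕ) : ℕ :=
  {α : Fin n → ℕ | IsMinGen K I α ∧ ∑ i, α i = d}.ncard

/-- `h_I(d)`: the number of monomials of degree exactly `d` not contained in `I`. -/
def hilb (K : Type*) [CommRing K] {n : ℕ} (I : Ideal (MvPolynomial (Fin n) K)) (d : ℕ) : ℕ :=
  {α : Fin n → ℕ | ∑ i, α i = d ∧ mono K α ∉ I}.ncard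

/-- The exponent vectors of the pure powers `x_i, x_i ^ 2, …, x_i ^ D`. -/
def purePowers (n D : ℕ) (i : Fin n) : Finset (Fin n → ℕ) :=
  (Finset.Icc 1 D).image fun d => Pi.single i d

theorem card_purePowers (n D : ℕ) (i : Fin n) : (purePowers n D i).card = D := by
  rw [purePowers, Finset.card_image_of_injective _ (Pi.single_injective i), Nat.card_Icc,
    Nat.add_sub_cancel]

theorem mem_monSet {n D : ℕ} {α : Fin n → ℕ} :
    α ∈ monSet n D ↔ 0 < ∑ i, α i ∧ ∑ i, α i ≤ D := by
  simp only [monSet, Finset.mem_filter, Fintype.mem_piFinset, Finset.mem_range,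
    and_iff_right_iff_imp]
  rintro ⟨-, h⟩ i
  exact Nat.lt_succ_of_le ((Finset.single_le_sum (fun _ _ => Nat.zero_le _)
    (Finset.mem_univ i)).trans h)

theorem purePowers_subset_monSet (n D : ℕ) (i : Fin n) : purePowers n D i ⊆ monSet n D := by
  intro α hα
  obtain ⟨d, hd, rfl⟩ := Finset.mem_image.1 hα
  rw [Finset.mem_Icc] at hd
  rw [mem_monSet]
  simp only [Finset.sum_pi_single', Finset.mem_univ, if_true]
  omega

theorem mem_purePowers_of_support {n D : ℕ} {α : Fin n → ℕ} (hα : α ∈ monSet n D) {i : Fin n}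
    (h : ∀ j, j ≠ i → α j = 0) : α ∈ purePowers n D i := by
  have hs : α = Pi.single i (α i) := by
    ext j
    by_cases hj : j = i
    · subst hj; simp
    · simp [hj, h j hj]
  rw [mem_monSet, Finset.sum_eq_single i (fun j _ hj => h j hj) (by simp)] at hα
  exact Finset.mem_image.2 ⟨α i, Finset.mem_Icc.2 ⟨hα.1, hα.2⟩, hs.symm⟩

theorem mono_single (K : Type*) [CommRing K] {n : ℕ} (i : Fin n) (d : ℕ) :
    mono K (Pi.single i d) = (X i : MvPolynomial (Fin n) K) ^ d := by
  rw [mono, Finsupp.equivFunOnFinite_symm_single, X_pow_eq_monomial]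

theorem isMaximal_ker_constantCoeff (K : Type*) [Field K] (σ : Type*) :
    (RingHom.ker (constantCoeff : MvPolynomial σ K →+* K)).IsMaximal :=
  RingHom.ker_isMaximal_of_surjective _ fun c => ⟨C c, constantCoeff_C _ c⟩

theorem ker_constantCoeff_le (K : Type*) [CommRing K] {σ : Type*}
    {P : Ideal (MvPolynomial σ K)} (h : ∀ i, X i ∈ P) :
    RingHom.ker (constantCoeff : MvPolynomial σ K →+* K) ≤ P := by
  intro f hf
  have hspan : Ideal.span (X '' (Set.univ : Set σ)) ≤ P := by
    rw [Ideal.span_le]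
    rintro _ ⟨i, -, rfl⟩
    exact h i
  refine hspan (mem_ideal_span_X_image.2 fun m hm => ?_)
  by_contra! hm0
  have : m = 0 := by ext i; exact hm0 i (Set.mem_univ i)
  subst this
  exact (mem_support_iff.1 hm) hf

theorem idealOf_le_ker_constantCoeff (K : Type*) [CommRing K] {n D : ℕ}
    {B : Finset (Fin n → ℕ)} (hB : B ⊆ monSet n D) :
    idealOf K B ≤ RingHom.ker (constantCoeff : MvPolynomial (Fin n) K →+* K) := by
  rw [idealOf, Ideal.span_le]
  rintro _ ⟨α, hα, rfl⟩
  have h := (mem_monSet.1 (hB hα)).1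
  rw [SetLike.mem_coe, RingHom.mem_ker, mono, constantCoeff_monomial, if_neg]
  intro h0
  have : α = 0 := by
    ext i
    simpa using DFunLike.congr_fun h0 i
  simp [this] at h

theorem ringKrullDim_quotient_idealOf_eq_zero (K : Type*) [Field K] {n D : ℕ}
    {B : Finset (Fin n → ℕ)} (hB : B ⊆ monSet n D)
    (h : ∀ i, ¬ Disjoint B (purePowers n D i)) :
    ringKrullDim (MvPolynomial (Fin n) K ⧸ idealOf K B) = 0 := by
  have hmax := isMaximal_ker_constantCoeff K (Fin n)
  have hne : idealOf K B ≠ ⊤ := fun htop =>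
    hmax.ne_top (top_le_iff.1 (htop ▸ idealOf_le_ker_constantCoeff K hB))
  have : Nontrivial (MvPolynomial (Fin n) K ⧸ idealOf K B) := Ideal.Quotient.nontrivial_iff.2 hne
  rw [← ringKrullDimZero_iff_ringKrullDim_eq_zero,
    Ideal.krullDimLE_zero_quotient_iff_forall_minimalPrimes_isMaximal]
  intro P hP
  have hprime : P.IsPrime := hP.1.1
  have hX : ∀ i, (X i : MvPolynomial (Fin n) K) ∈ P := by
    intro i
    obtain ⟨α, hαB, hα⟩ := Finset.not_disjoint_iff.1 (h i)
    obtain ⟨d, -, rfl⟩ := Finset.mem_image.1 hα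
    refine hprime.mem_of_pow_mem d (mono_single K i d ▸ hP.1.2 (Ideal.subset_span ?_))
    exact ⟨_, hαB, rfl⟩
  exact hmax.eq_of_le hprime.ne_top (ker_constantCoeff_le K hX) ▸ hmax

theorem one_le_ringKrullDim_quotient_idealOf (K : Type*) [Field K] {n D : ℕ}
    {B : Finset (Fin n → ℕ)} (hB : B ⊆ monSet n D) {i : Fin n}
    (h : Disjoint B (purePowers n D i)) :
    1 ≤ ringKrullDim (MvPolynomial (Fin n) K ⧸ idealOf K B) := by
  let φ : MvPolynomial (Fin n) K →ₐ[K] Polynomial K := aeval (Pi.single i Polynomial.X)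
  have hφ : ∀ f ∈ idealOf K B, φ.toRingHom f = 0 := by
    suffices idealOf K B ≤ RingHom.ker φ.toRingHom from fun f hf => this hf
    rw [idealOf, Ideal.span_le]
    rintro _ ⟨α, hα, rfl⟩
    obtain ⟨j, hji, hj⟩ : ∃ j, j ≠ i ∧ α j ≠ 0 := by
      by_contra! hall
      exact Finset.disjoint_left.1 h hα (mem_purePowers_of_support (hB hα) hall)
    change φ (mono K α) = 0
    rw [mono, aeval_monomial, Finsupp.prod_fintype _ _ (fun _ => pow_zero _),
      Finset.prod_eq_zero (Finset.mem_univ j), mul_zero]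
    simp [hji, hj]
  have hsurj : Function.Surjective φ := by
    intro g
    refine ⟨Polynomial.aeval (X i) g, ?_⟩
    rw [← Polynomial.aeval_algHom_apply]
    simp [φ]
  have hle := ringKrullDim_le_of_surjective (Ideal.Quotient.lift (idealOf K B) φ.toRingHom hφ)
    (Ideal.Quotient.lift_surjective_of_surjective _ hφ hsurj)
  rwa [Polynomial.ringKrullDim_of_isNoetherianRing, ringKrullDim_eq_zero_of_field, zero_add]
    at hle

theorem ringKrullDim_quotient_idealOf_eq_zero_iff (K : Type*) [Field K] {n D : ℕ}
    {B : Finset (Fin n → ℕ)} (hB : B ⊆ monSet n D) :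
    ringKrullDim (MvPolynomial (Fin n) K ⧸ idealOf K B) = 0 ↔
      ∀ i, ¬ Disjoint B (purePowers n D i) := by
  refine ⟨fun h0 i hi => ?_, ringKrullDim_quotient_idealOf_eq_zero K hB⟩
  have h1 := one_le_ringKrullDim_quotient_idealOf K hB hi
  rw [h0] at h1
  exact absurd h1 (by decide)

theorem ERprob_weight_nonneg {p : ℝ} (h0 : 0 ≤ p) (h1 : p ≤ 1) (a b : ℕ) :
    0 ≤ p ^ a * (1 - p) ^ b :=
  mul_nonneg (pow_nonneg h0 _) (pow_nonneg (sub_nonneg.2 h1) _)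

theorem ERprob_nonneg {n D : ℕ} {p : ℝ} (h0 : 0 ≤ p) (h1 : p ≤ 1)
    (E : Set (Finset (Fin n → ℕ))) : 0 ≤ ERprob n D p E :=
  Finset.sum_nonneg fun _ _ => ERprob_weight_nonneg h0 h1 _ _

theorem ERprob_mono {n D : ℕ} {p : ℝ} (h0 : 0 ≤ p) (h1 : p ≤ 1)
    {E F : Set (Finset (Fin n → ℕ))} (h : ∀ B ⊆ monSet n D, B ∈ E → B ∈ F) :
    ERprob n D p E ≤ ERprob n D p F := by
  classical
  refine Finset.sum_le_sum_of_subset_of_nonneg (fun B hB => ?_)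
    fun _ _ _ => ERprob_weight_nonneg h0 h1 _ _
  rw [Finset.mem_filter] at hB ⊢
  exact ⟨hB.1, h B (Finset.mem_powerset.1 hB.1) hB.2⟩

theorem ERprob_add_compl (n D : ℕ) (p : ℝ) (E : Set (Finset (Fin n → ℕ))) :
    ERprob n D p E + ERprob n D p Eᶜ = 1 := by
  classical
  have h := Finset.sum_pow_mul_eq_add_pow p (1 - p) (monSet n D)
  rw [add_sub_cancel, one_pow] at h
  rw [← h, ← Finset.sum_filter_add_sum_filter_not _ (· ∈ E)]
  simp only [ERprob, Set.mem_compl_iff]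

theorem ERprob_iUnion_le {n D : ℕ} {p : ℝ} (h0 : 0 ≤ p) (h1 : p ≤ 1) {ι : Type*} [Fintype ι]
    (E : ι → Set (Finset (Fin n → ℕ))) :
    ERprob n D p (⋃ i, E i) ≤ ∑ i, ERprob n D p (E i) := by
  classical
  simp only [ERprob, Finset.sum_filter]
  rw [Finset.sum_comm]
  refine Finset.sum_le_sum fun B _ => ?_
  have hw := ERprob_weight_nonneg h0 h1 B.card ((monSet n D).card - B.card)
  have hterm : ∀ i ∈ Finset.univ, 0 ≤ if B ∈ E i then
      p ^ B.card * (1 - p) ^ ((monSet n D).card - B.card) else 0 := fun i _ => by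
    split_ifs
    exacts [hw, le_rfl]
  split_ifs with hB
  · obtain ⟨i, hi⟩ := Set.mem_iUnion.1 hB
    refine le_trans ?_ (Finset.single_le_sum hterm (Finset.mem_univ i))
    rw [if_pos hi]
  · exact Finset.sum_nonneg hterm

theorem ERprob_disjoint {n D : ℕ} (p : ℝ) {A : Finset (Fin n → ℕ)} (hA : A ⊆ monSet n D) :
    ERprob n D p {B | Disjoint B A} = (1 - p) ^ A.card := by
  classical
  have hfilter : (monSet n D).powerset.filter (· ∈ {B | Disjoint B A}) =
      (monSet n D \ A).powerset := by
    ext B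
    simp [Finset.subset_sdiff]
  have hsum := Finset.sum_pow_mul_eq_add_pow p (1 - p) (monSet n D \ A)
  rw [add_sub_cancel, one_pow] at hsum
  refine Eq.trans ?_ ((congrArg ((1 - p) ^ A.card * ·) hsum).trans (mul_one _))
  rw [Finset.mul_sum, ERprob]
  refine Finset.sum_congr (by convert hfilter) fun B hB => ?_
  have hBc := Finset.card_le_card (Finset.mem_powerset.1 hB)
  have hAc := Finset.card_sdiff_add_card_eq_card hA
  rw [mul_left_comm, ← pow_add]
  congr 2
  omega

/-- A zero-dimensional quotient needs a power of the variable `x_i` among the generators. -/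
theorem ERprob_dim_zero_le (K : Type*) [Field K] {n : ℕ} (D : ℕ) (i : Fin n) {p : ℝ}
    (h0 : 0 ≤ p) (h1 : p ≤ 1) :
    ERprob n D p {B | ringKrullDim (MvPolynomial (Fin n) K ⧸ idealOf K B)
      = (0 : WithBot (WithTop ℕ))} ≤ D * p := by
  have hmono := ERprob_mono (n := n) (D := D) h0 h1
    (E := {B | ringKrullDim (MvPolynomial (Fin n) K ⧸ idealOf K B) = (0 : WithBot (WithTop ℕ))})
    (F := {B | Disjoint B (purePowers n D i)}ᶜ)
    fun B hB hE => (ringKrullDim_quotient_idealOf_eq_zero_iff K hB).1 hE i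
  have hcompl := ERprob_add_compl n D p {B | Disjoint B (purePowers n D i)}
  rw [ERprob_disjoint p (purePowers_subset_monSet n D i), card_purePowers] at hcompl
  have hbern := one_add_mul_le_pow (a := -p) (by linarith) D
  rw [← sub_eq_add_neg] at hbern
  linarith

/-- Union bound over the variables having no power among the generators. -/
theorem one_sub_le_ERprob_dim_zero (K : Type*) [Field K] (n D : ℕ) {p : ℝ}
    (h0 : 0 ≤ p) (h1 : p ≤ 1) :
    1 - n * Real.exp (-(D * p)) ≤
      ERprob n D p {B | ringKrullDim (MvPolynomial (Fin n) K ⧸ idealOf K B)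
        = (0 : WithBot (WithTop ℕ))} := by
  set E : Set (Finset (Fin n → ℕ)) :=
    {B | ringKrullDim (MvPolynomial (Fin n) K ⧸ idealOf K B) = (0 : WithBot (WithTop ℕ))}
  have hmono := ERprob_mono (n := n) (D := D) h0 h1 (E := Eᶜ)
    (F := ⋃ i, {B | Disjoint B (purePowers n D i)}) fun B hB hE => by
      by_contra hF
      refine hE (ringKrullDim_quotient_idealOf_eq_zero K hB fun i hi => hF ?_)
      exact Set.mem_iUnion.2 ⟨i, hi⟩
  have hunion := ERprob_iUnion_le (D := D) h0 h1
    fun i : Fin n => {B | Disjoint B (purePowers n D i)}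
  simp only [ERprob_disjoint p (purePowers_subset_monSet n D _), card_purePowers,
    Finset.sum_const, Finset.card_univ, Fintype.card_fin, nsmul_eq_mul] at hunion
  have hexp : (1 - p) ^ D ≤ Real.exp (-(D * p)) := by
    rw [← mul_neg, Real.exp_nat_mul]
    exact pow_le_pow_left₀ (sub_nonneg.2 h1) (Real.one_sub_le_exp_neg p) D
  have hn := mul_le_mul_of_nonneg_left hexp (Nat.cast_nonneg (α := ℝ) n)
  linarith [ERprob_add_compl n D p E]

/-- Corollary 3.5. For fixed `n`, `1/D` is a threshold function for
`0`-dimensionality of `S/𝔍`: if `D·p(D) → 0` then `P(dim S/𝔍 = 0) → 0`, and if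
`D·p(D) → ∞` then `P(dim S/𝔍 = 0) → 1`. -/
theorem stmt10 (K : Type*) [Field K] (n : ℕ) (hn : 1 ≤ n)
    (p : ℕ → ℝ) (hp : ∀ D, 0 < p D ∧ p D < 1) :
    (Filter.Tendsto (fun D : ℕ => (D : ℝ) * p D) Filter.atTop (nhds 0) →
      Filter.Tendsto (fun D : ℕ => ERprob n D (p D)
          {B | ringKrullDim (MvPolynomial (Fin n) K ⧸ idealOf K B)
            = (0 : WithBot (WithTop ℕ))})
        Filter.atTop (nhds 0)) ∧
    (Filter.Tendsto (fun D : ℕ => (D : ℝ) * p D) Filter.atTop Filter.atTop →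
      Filter.Tendsto (fun D : ℕ => ERprob n D (p D)
          {B | ringKrullDim (MvPolynomial (Fin n) K ⧸ idealOf K B)
            = (0 : WithBot (WithTop ℕ))})
        Filter.atTop (nhds 1)) := by
  refine ⟨fun h => ?_, fun h => ?_⟩
  · exact squeeze_zero (fun D => ERprob_nonneg (hp D).1.le (hp D).2.le _)
      (fun D => ERprob_dim_zero_le K D ⟨0, hn⟩ (hp D).1.le (hp D).2.le) h
  · have hlim : Tendsto (fun D : ℕ => 1 - (n : ℝ) * Real.exp (-(D * p D))) atTop (nhds 1) := by
      simpa using ((Real.tendsto_exp_neg_atTop_nhds_zero.comp h).const_mul (n : ℝ)).const_sub 1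
    refine tendsto_of_tendsto_of_tendsto_of_le_of_le hlim tendsto_const_nhds
      (fun D => one_sub_le_ERprob_dim_zero K n D (hp D).1.le (hp D).2.le) fun D => ?_
    have h0 := ERprob_nonneg (D := D) (hp D).1.le (hp D).2.le
      {B | ringKrullDim (MvPolynomial (Fin n) K ⧸ idealOf K B) = (0 : WithBot (WithTop ℕ))}ᶜ
    exact (le_add_of_nonneg_right h0).trans_eq (ERprob_add_compl n D (p D) _)

end
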